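/- There do not exist a real number c > 0 and a unique representation basis A of the integers such that A(-x,x) ≥ c·√x for all real numbers x ≥ 1. Equivalently, for every unique representation basis A and every c > 0 there exist arbitrarily large real numbers x with A(-x,x) < c·√x. -/

import Mathlib

open Filter Set

/-- `repCount A n` is the number of representations of `n` as `a + a'` with
`a ≤ a'` and `a, a' ∈ A`. -/
noncomputable def repCount (A : Set ℤ) (n : ℤ) : ℕ :=
  {p : ℤ × ℤ | p.1 ∈ A ∧ p.2 ∈ A ∧ p.1 ≤ p.2 ∧ p.1 + p.2 = n}.ncard

/-- `A` is a unique representation basis of `ℤ` if `r_A(n) = 1` for all `n`. -/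
def IsUniqueRepBasis (A : Set ℤ) : Prop := ∀ n : ℤ, repCount A n = 1

/-- `countIn A y x` is the number of elements of `A` in the real interval `[y, x]`. -/
noncomputable def countIn (A : Set ℤ) (y x : ℝ) : ℕ :=
  {a : ℤ | a ∈ A ∧ y ≤ (a : ℝ) ∧ (a : ℝ) ≤ x}.ncard

/-- Elements of `A` with absolute value at most `n`. -/
noncomputable def urbF (A : Set ℤ) (n : ℕ) : Finset ℤ := by
  classical exact (Finset.Icc (-(n : ℤ)) n).filter (· ∈ A)

lemma mem_urbF {A : Set ℤ} {n : ℕ} {a : ℤ} : a ∈ urbF A n ↔ (-(n : ℤ) ≤ a ∧ a ≤ n) ∧ a ∈ A := by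
  classical
  simp [urbF]

lemma countIn_eq (A : Set ℤ) (n : ℕ) : countIn A (-(n : ℝ)) n = (urbF A n).card := by
  unfold countIn
  rw [← Set.ncard_coe_finset]
  congr 1
  ext a
  simp only [Set.mem_ofPred_eq, Finset.mem_coe, mem_urbF]
  have h1 : (-(n : ℝ) ≤ (a : ℝ)) ↔ -(n : ℤ) ≤ a := by
    rw [← Int.cast_le (R := ℝ)]; push_cast; rfl
  have h2 : ((a : ℝ) ≤ (n : ℝ)) ↔ a ≤ (n : ℤ) := by
    rw [← Int.cast_le (R := ℝ)]; push_cast; rfl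
  rw [h1, h2]; tauto

/-- Nonzero differences are distinct. -/
lemma urb_diff {A : Set ℤ} (hA : IsUniqueRepBasis A) {a b c d : ℤ} (ha : a ∈ A) (hb : b ∈ A)
    (hc : c ∈ A) (hd : d ∈ A) (hab : a ≠ b) (h : a - b = c - d) : a = c ∧ b = d := by
  have h1 := hA (a + d)
  unfold repCount at h1
  rw [Set.ncard_eq_one] at h1
  obtain ⟨p, hp⟩ := h1
  have key : ∀ x y : ℤ, x ∈ A → y ∈ A → x + y = a + d → (min x y, max x y) = p := by
    intro x y hx hy hxy
    have : (min x y, max x y) ∈ ({p} : Set (ℤ × ℤ)) := by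
      rw [← hp]
      refine ⟨?_, ?_, ?_, ?_⟩
      · rcases min_choice x y with h | h <;> simp [h, hx, hy]
      · rcases max_choice x y with h | h <;> simp [h, hx, hy]
      · simp
      · simp [hxy]
    simpa using this
  have e1 := key a d ha hd rfl
  have e2 := key c b hc hb (by omega)
  have e3 := e1.trans e2.symm
  simp only [Prod.mk.injEq] at e3
  omega

/-- Pairs of `S` lying in a common interval of length `N`. -/
def urbP (N : ℕ) (S : Finset ℤ) : Finset (ℤ × ℤ) :=
  (S ×ˢ S).filter (fun p => p.1 / (N : ℤ) = p.2 / (N : ℤ))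

lemma offdiag_le {A : Set ℤ} (hA : IsUniqueRepBasis A) (P : Finset (ℤ × ℤ)) (M : ℕ)
    (hP : ∀ p ∈ P, p.1 ∈ A ∧ p.2 ∈ A ∧ p.1 ≠ p.2 ∧ -(M : ℤ) ≤ p.1 - p.2 ∧ p.1 - p.2 ≤ M) :
    P.card ≤ 2 * M := by
  have : P.card ≤ ((Finset.Icc (-(M : ℤ)) M).erase 0).card := by
    apply Finset.card_le_card_of_injOn (fun p => p.1 - p.2)
    · intro p hp
      obtain ⟨_, _, h3, h4, h5⟩ := hP p hp
      simp only [Finset.coe_erase, Finset.coe_Icc, Set.mem_sdiff, Set.mem_Icc, Set.mem_singleton_iff]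
      exact ⟨⟨h4, h5⟩, by omega⟩
    · intro p hp q hq h
      obtain ⟨h1, h2, h3, _, _⟩ := hP p hp
      obtain ⟨k1, k2, _, _, _⟩ := hP q hq
      have := urb_diff hA h1 h2 k1 k2 h3 h
      exact Prod.ext this.1 this.2
  rw [Finset.card_erase_of_mem (by simp), Int.card_Icc] at this
  omega

lemma urbF_card_sq {A : Set ℤ} (hA : IsUniqueRepBasis A) {n : ℕ} (hn : 1 ≤ n) :
    (urbF A n).card ^ 2 ≤ 8 * n := by
  have h := offdiag_le hA (urbF A n).offDiag (2 * n) (by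
    intro p hp
    simp only [Finset.mem_offDiag, mem_urbF] at hp
    obtain ⟨⟨h1, h2⟩, ⟨h3, h4⟩, h5⟩ := hp
    refine ⟨h2, h4, h5, ?_, ?_⟩ <;> push_cast <;> omega)
  rw [Finset.offDiag_card] at h
  have h' : (urbF A n).card * (urbF A n).card ≤ 4 * n + (urbF A n).card := by omega
  by_cases h2 : 2 ≤ (urbF A n).card <;> nlinarith

lemma urbP_le {A : Set ℤ} (hA : IsUniqueRepBasis A) {N : ℕ} (hN : 1 ≤ N) (S : Finset ℤ)
    (hS : ∀ a ∈ S, a ∈ A) : (urbP N S).card ≤ 2 * N + S.card := by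
  have h := offdiag_le hA ((urbP N S).filter (fun p => p.1 ≠ p.2)) N (by
    intro p hp
    simp only [urbP, Finset.mem_filter, Finset.mem_product] at hp
    obtain ⟨⟨⟨h1, h2⟩, h3⟩, h4⟩ := hp
    have hN' : (0 : ℤ) < N := by exact_mod_cast hN
    have e1 := Int.emod_add_mul_ediv p.1 N
    have e2 := Int.emod_add_mul_ediv p.2 N
    have l1 := Int.emod_nonneg p.1 hN'.ne'
    have l2 := Int.emod_nonneg p.2 hN'.ne'
    have l3 := Int.emod_lt_of_pos p.1 hN'
    have l4 := Int.emod_lt_of_pos p.2 hN'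
    rw [h3] at e1
    exact ⟨hS _ h1, hS _ h2, h4, by omega, by omega⟩)
  have h2 : ((urbP N S).filter (fun p => ¬ p.1 ≠ p.2)).card ≤ S.card := by
    apply Finset.card_le_card_of_injOn (fun p => p.1)
    · intro p hp
      simp only [urbP, Finset.coe_filter, Finset.mem_filter, Finset.mem_product,
        Set.mem_ofPred_eq] at hp
      exact hp.1.1.1
    · intro p hp q hq h
      simp only [urbP, Finset.coe_filter, Finset.mem_filter, Finset.mem_product,
        Set.mem_ofPred_eq, not_not] at hp hq
      have h : p.1 = q.1 := h
      exact Prod.ext h (by rw [← hp.2, ← hq.2, h])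
  have h3 := Finset.card_filter_add_card_filter_not (s := urbP N S) (fun p => p.1 ≠ p.2)
  omega

lemma urbP_ge {N : ℕ} (S T : Finset ℤ) (hT : ∀ a ∈ S, a / (N : ℤ) ∈ T) :
    S.card ^ 2 ≤ T.card * (urbP N S).card := by
  have h1 : S.card = ∑ q ∈ T, (S.filter (fun a => a / (N : ℤ) = q)).card :=
    Finset.card_eq_sum_card_fiberwise hT
  have h2 : (urbP N S).card = ∑ q ∈ T, ((urbP N S).filter (fun p => p.1 / (N : ℤ) = q)).card :=
    Finset.card_eq_sum_card_fiberwise (by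
      intro p hp
      simp only [urbP, Finset.coe_filter, Finset.mem_product, Set.mem_ofPred_eq] at hp
      exact hT _ hp.1.1)
  have h3 : ∀ q, ((urbP N S).filter (fun p => p.1 / (N : ℤ) = q)).card =
      (S.filter (fun a => a / (N : ℤ) = q)).card ^ 2 := by
    intro q
    rw [sq, ← Finset.card_product]
    congr 1
    ext p
    simp only [urbP, Finset.mem_filter, Finset.mem_product]
    constructor
    · rintro ⟨⟨⟨a, b⟩, c⟩, d⟩
      exact ⟨⟨a, d⟩, b, c ▸ d⟩
    · rintro ⟨⟨a, d⟩, b, c⟩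
      exact ⟨⟨⟨a, b⟩, d.trans c.symm⟩, d⟩
  rw [h2, h1]
  simp only [h3]
  exact sq_sum_le_card_mul_sum_sq

/-- There do not exist `c > 0` and a unique representation basis `A` with
`A(-x,x) ≥ c √x` for all real `x ≥ 1`. -/
theorem not_exists_urb_ge_sqrt_everywhere :
    ¬ ∃ c : ℝ, 0 < c ∧ ∃ A : Set ℤ, IsUniqueRepBasis A ∧
      ∀ x : ℝ, 1 ≤ x → c * Real.sqrt x ≤ (countIn A (-x) x : ℝ) := by
  rintro ⟨c, hc, A, hA, hx⟩
  obtain ⟨k, hk⟩ := exists_nat_ge (4 / c)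
  have hck : 4 ≤ c * k := by rw [div_le_iff₀ hc] at hk; linarith
  have hk1 : 1 ≤ k := by
    rcases Nat.eq_zero_or_pos k with h | h
    · subst h; norm_num at hck
    · exact h
  set K := k ^ 2 with hK
  have hK1 : 1 ≤ K := Nat.one_le_pow _ _ hk1
  set m := 15 * K + 1 with hm
  set N := K ^ m with hN
  have hN1 : 1 ≤ N := Nat.one_le_pow _ _ hK1
  have hX1 : ∀ i, 1 ≤ N * K ^ i := fun i => Nat.mul_pos hN1 (Nat.one_le_pow _ _ hK1)
  have hmono : ∀ a b : ℕ, a ≤ b → urbF A a ⊆ urbF A b := by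
    intro a b hab x
    simp only [mem_urbF]
    rintro ⟨⟨h1, h2⟩, h3⟩
    exact ⟨⟨by omega, by omega⟩, h3⟩
  have hXmono : ∀ i j, i ≤ j → N * K ^ i ≤ N * K ^ j := fun i j h =>
    Nat.mul_le_mul_left _ (Nat.pow_le_pow_right hK1 h)
  -- growth
  have hgrow : ∀ n : ℕ, 1 ≤ n → n ≤ (urbF A (n * K) \ urbF A n).card ^ 2 := by
    intro n hn
    have hnK : n ≤ n * K := Nat.le_mul_of_pos_right _ hK1
    have h1 := hx ((n * K : ℕ) : ℝ) (by exact_mod_cast hn.trans hnK)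
    rw [countIn_eq] at h1
    have hs : Real.sqrt ((n * K : ℕ) : ℝ) = Real.sqrt n * k := by
      rw [hK]; push_cast
      rw [Real.sqrt_mul (by positivity), Real.sqrt_sq (by positivity)]
    rw [hs] at h1
    have h2 : ((urbF A n).card : ℝ) ≤ 3 * Real.sqrt n := by
      have := urbF_card_sq hA hn
      have h' : ((urbF A n).card : ℝ) ^ 2 ≤ 8 * n := by exact_mod_cast this
      have hsq := Real.sq_sqrt (Nat.cast_nonneg (α := ℝ) n)
      apply (sq_le_sq₀ (by positivity) (by positivity)).1
      nlinarith [Real.sqrt_nonneg (n : ℝ)]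
    have h3 : (urbF A (n * K)).card = (urbF A (n * K) \ urbF A n).card + (urbF A n).card :=
      (Finset.card_sdiff_add_card_eq_card (hmono _ _ hnK)).symm
    have h3' : ((urbF A (n * K)).card : ℝ) =
      (urbF A (n * K) \ urbF A n).card + (urbF A n).card := by exact_mod_cast h3
    have hsn := Real.sqrt_nonneg (n : ℝ)
    have h4 : Real.sqrt n ≤ (urbF A (n * K) \ urbF A n).card := by nlinarith
    have h5 : (n : ℝ) ≤ ((urbF A (n * K) \ urbF A n).card : ℝ) ^ 2 := by
      rw [← Real.sq_sqrt (Nat.cast_nonneg n)]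
      exact pow_le_pow_left₀ hsn h4 2
    exact_mod_cast h5
  -- blocks
  let S : ℕ → Finset ℤ := fun i => urbF A (N * K ^ (i + 1)) \ urbF A (N * K ^ i)
  have hblock : ∀ i, N ≤ 3 * K * (urbP N (S i)).card := by
    intro i
    have h1 := hgrow (N * K ^ i) (hX1 i)
    rw [mul_assoc, ← pow_succ] at h1
    have h2 := urbP_ge (N := N) (S i) (Finset.Icc (-((K ^ (i + 1) : ℕ) : ℤ)) (K ^ (i + 1) : ℕ)) (by
      intro a ha
      have ha := (mem_urbF.1 (Finset.mem_sdiff.1 ha).1).1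
      have hN' : (0 : ℤ) < N := by exact_mod_cast hN1
      rw [Finset.mem_Icc]
      constructor
      · rw [Int.le_ediv_iff_mul_le hN']
        have := ha.1; push_cast at this ⊢; linarith
      · apply Int.ediv_le_of_le_mul hN'
        have := ha.2; push_cast at this ⊢; linarith)
    rw [Int.card_Icc] at h2
    have h3 : ((((K ^ (i + 1) : ℕ) : ℤ) + 1 - -((K ^ (i + 1) : ℕ) : ℤ)).toNat) ≤ 3 * K ^ (i + 1) := by
      have : 1 ≤ K ^ (i + 1) := Nat.one_le_pow _ _ hK1
      omega
    have h4 := (h1.trans h2).trans (Nat.mul_le_mul_right _ h3)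
    have hKi : 0 < K ^ i := Nat.one_le_pow _ _ hK1
    apply Nat.le_of_mul_le_mul_right _ hKi
    calc N * K ^ i ≤ _ := h4
      _ = _ := by ring
  -- assemble
  set U := urbF A (N * K ^ m) with hU
  have hsum : ∑ i ∈ Finset.range m, (urbP N (S i)).card ≤ (urbP N U).card := by
    rw [← Finset.card_biUnion]
    · apply Finset.card_le_card
      intro p hp
      simp only [Finset.mem_biUnion, Finset.mem_range, urbP, Finset.mem_filter,
        Finset.mem_product] at hp ⊢
      obtain ⟨i, hi, ⟨h1, h2⟩, h3⟩ := hp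
      have hsub := hmono _ _ (hXmono (i + 1) m hi)
      exact ⟨⟨hsub (Finset.mem_sdiff.1 h1).1, hsub (Finset.mem_sdiff.1 h2).1⟩, h3⟩
    · have key : ∀ i j, i < j → Disjoint (urbP N (S i)) (urbP N (S j)) := by
        intro i j hij
        rw [Finset.disjoint_left]
        intro p hp hq
        simp only [urbP, Finset.mem_filter, Finset.mem_product] at hp hq
        exact (Finset.mem_sdiff.1 hq.1.1).2
          (hmono _ _ (hXmono (i + 1) j hij) (Finset.mem_sdiff.1 hp.1.1).1)
      intro i _ j _ hij
      rcases lt_or_gt_of_ne hij with h | h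
      · exact key i j h
      · exact (key j i h).symm
  have hup := urbP_le hA hN1 U (fun a ha => (mem_urbF.1 ha).2)
  have hUc := urbF_card_sq hA (hX1 m)
  rw [← hU, ← hN] at hUc
  have hU3 : U.card ≤ 3 * N := by nlinarith
  have hlow : m * N ≤ 3 * K * ∑ i ∈ Finset.range m, (urbP N (S i)).card := by
    rw [Finset.mul_sum]
    calc m * N = ∑ i ∈ Finset.range m, N := by simp
      _ ≤ _ := Finset.sum_le_sum (fun i _ => hblock i)
  have : m * N ≤ 3 * K * (5 * N) :=
    hlow.trans (Nat.mul_le_mul_left _ (hsum.trans (by omega)))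
  have h6 : m ≤ 15 * K := by
    apply Nat.le_of_mul_le_mul_right _ hN1
    linarith
  omega
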